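/- Let X be a standard Gaussian random variable and let Y = H₆(X) = X⁶ − 15X⁴ + 45X² − 15. Define the operator S₆ f(y) = y f(y) + (−1278y − 720) f'(y) + (−972y² + 103320y + 756000) f''(y) + (−216y³ + 228960y² + 16491600y − 120528000) f^{(3)}(y) + (71280y³ + 6771600y² − 307152000y − 3265920000) f^{(4)}(y) + (−314928000y² − 19945440000y + 125971200000) f^{(5)}(y) + (−209952000y³ − 19945440000y² + 251942400000y + 7558272000000) f^{(6)}(y). Let W be a real-valued random variable with E[|W|³] < ∞. Then W is equal in law to H₆(X) if and only if E[S₆ f(W)] = 0 for all f ∈ F_{S₆,Y}. -/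

import Mathlib

open MeasureTheory ProbabilityTheory Filter Set
open scoped Topology

/-- The standard Gaussian distribution, with density `(2π)^(-1/2) exp(-x²/2)` on `ℝ`. -/
noncomputable def stdGaussian : Measure ℝ :=
  volume.withDensity fun x =>
    ENNReal.ofReal ((Real.sqrt (2 * Real.pi))⁻¹ * Real.exp (-x ^ 2 / 2))

/-- The law of `H₆(X) = X⁶ - 15X⁴ + 45X² - 15` for `X` standard Gaussian. -/
noncomputable def lawH6 : Measure ℝ :=
  Measure.map (fun x : ℝ => x ^ 6 - 15 * x ^ 4 + 45 * x ^ 2 - 15) stdGaussian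

/-- The Stein operator `S₆` for `H₆(X)` with coefficients of minimal polynomial
degree (`T = 6`, `m = 3`). -/
noncomputable def steinH6 (f : ℝ → ℝ) (y : ℝ) : ℝ :=
  y * f y + (-1278 * y - 720) * deriv f y
    + (-972 * y ^ 2 + 103320 * y + 756000) * iteratedDeriv 2 f y
    + (-216 * y ^ 3 + 228960 * y ^ 2 + 16491600 * y - 120528000) * iteratedDeriv 3 f y
    + (71280 * y ^ 3 + 6771600 * y ^ 2 - 307152000 * y - 3265920000) * iteratedDeriv 4 f y
    + (-314928000 * y ^ 2 - 19945440000 * y + 125971200000) * iteratedDeriv 5 f y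
    + (-209952000 * y ^ 3 - 19945440000 * y ^ 2 + 251942400000 * y + 7558272000000) *
        iteratedDeriv 6 f y

/-- Membership in the class `F_{S₆,Y}` (here `T = 6`, `m = 3`, `I = ℝ`). -/
def memFH6 (f : ℝ → ℝ) : Prop :=
  ContDiff ℝ 6 f ∧
    ∀ t ≤ 6, ∀ j ≤ 3, Integrable (fun y => y ^ j * iteratedDeriv t f y) lawH6

lemma stdGaussian_eq : _root_.stdGaussian = gaussianReal 0 1 := by
  rw [gaussianReal_of_var_ne_zero _ one_ne_zero]
  unfold _root_.stdGaussian gaussianPDF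
  congr 1
  ext x
  simp [gaussianPDFReal]

instance : IsProbabilityMeasure _root_.stdGaussian := by
  rw [stdGaussian_eq]; infer_instance

def H6 (x : ℝ) : ℝ := x ^ 6 - 15 * x ^ 4 + 45 * x ^ 2 - 15

lemma H6_cont : Continuous H6 := by unfold H6; fun_prop

lemma lawH6_eq : lawH6 = Measure.map H6 _root_.stdGaussian := rfl

instance : IsProbabilityMeasure lawH6 := by
  rw [lawH6_eq]; exact Measure.isProbabilityMeasure_map H6_cont.aemeasurable

lemma H6_ge (x : ℝ) : -200 ≤ H6 x := by
  unfold H6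
  have : 0 ≤ x ^ 2 := sq_nonneg x
  nlinarith [mul_nonneg this (sq_nonneg (x ^ 2 - 8)), sq_nonneg (x ^ 2 - 8), sq_nonneg (x^2 - 9)]

lemma lawH6_ge : ∀ᵐ y ∂lawH6, -200 ≤ y := by
  rw [lawH6_eq, ae_map_iff H6_cont.aemeasurable measurableSet_Ici]
  exact ae_of_all _ H6_ge

lemma pow_le_H6 (x : ℝ) (k : ℕ) (hk : k ≤ 18) : |x| ^ k ≤ 1000000000000 * (1 + |H6 x| ^ 3) := by
  have h1 : |x| ^ k ≤ 1 + x ^ 18 := by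
    rcases le_total |x| 1 with h | h
    · have : |x| ^ k ≤ 1 := pow_le_one₀ (abs_nonneg _) h
      have : 0 ≤ x ^ 18 := by positivity
      linarith
    · have h2 : |x| ^ k ≤ |x| ^ 18 := pow_le_pow_right₀ h hk
      have : |x| ^ 18 = x ^ 18 := by rw [Even.pow_abs]; decide
      linarith
  have h2 : x ^ 6 ≤ 2 * |H6 x| + 3000 := by
    have := le_abs_self (H6 x)
    have h : x ^ 6 ≤ 2 * H6 x + 3000 := by
      unfold H6
      have : 0 ≤ x ^ 2 := sq_nonneg x
      nlinarith [mul_nonneg this (sq_nonneg (x ^ 2 - 18)), sq_nonneg (x ^ 2 - 18)]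
    linarith
  have h3 : x ^ 18 ≤ (2 * |H6 x| + 3000) ^ 3 := by
    have : x ^ 18 = (x ^ 6) ^ 3 := by ring
    rw [this]; gcongr
  have h0 : 0 ≤ |H6 x| := abs_nonneg _
  set z := |H6 x|
  have h4 : (2 * z + 3000) ^ 3 ≤ 4 * ((2 * z) ^ 3 + 3000 ^ 3) := by
    nlinarith [mul_nonneg (by positivity : 0 ≤ 2 * z + 3000) (sq_nonneg (2 * z - 3000))]
  have h5 : 0 ≤ z ^ 3 := by positivity
  nlinarith

lemma integrable_map_H6 (F : ℝ → ℝ) (hF : Continuous F)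
    (h : ∀ j ≤ 3, Integrable (fun y => y ^ j * F y) lawH6) (k : ℕ) (hk : k ≤ 18) :
    Integrable (fun x => x ^ k * F (H6 x)) _root_.stdGaussian := by
  have i0 : Integrable (fun x => F (H6 x)) _root_.stdGaussian := by
    have := h 0 (by norm_num)
    rw [lawH6_eq, integrable_map_measure (by fun_prop) H6_cont.aemeasurable] at this
    simpa [Function.comp_def] using this
  have i3 : Integrable (fun x => H6 x ^ 3 * F (H6 x)) _root_.stdGaussian := by
    have := h 3 (by norm_num)
    rwa [lawH6_eq, integrable_map_measure (by fun_prop) H6_cont.aemeasurable] at this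
  have := H6_cont
  refine ((i0.norm.add i3.norm).const_mul 1000000000000).mono' (by fun_prop) (ae_of_all _ ?_)
  intro x
  have hx := pow_le_H6 x k hk
  simp only [Pi.add_apply, norm_mul, norm_pow, Real.norm_eq_abs]
  have : |x| ^ k * |F (H6 x)| ≤ 1000000000000 * (1 + |H6 x| ^ 3) * |F (H6 x)| := by gcongr
  linarith

noncomputable def rho (x : ℝ) : ℝ := (Real.sqrt (2 * Real.pi))⁻¹ * Real.exp (-x ^ 2 / 2)

lemma rho_nonneg (x : ℝ) : 0 ≤ rho x := by unfold rho; positivity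

lemma rho_cont : Continuous rho := by unfold rho; fun_prop

lemma rho_deriv (x : ℝ) : HasDerivAt rho (-x * rho x) x := by
  have h : HasDerivAt (fun x : ℝ => -x ^ 2 / 2) (-x) x := by
    have := ((hasDerivAt_pow 2 x).neg).div_const 2
    exact HasDerivAt.congr_deriv this (by norm_num; ring)
  have := (h.exp).const_mul (Real.sqrt (2 * Real.pi))⁻¹
  exact HasDerivAt.congr_deriv (f := rho) this (by unfold rho; ring)

lemma integrable_gauss (f : ℝ → ℝ) :
    Integrable f _root_.stdGaussian ↔ Integrable (fun x => rho x * f x) := by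
  unfold _root_.stdGaussian
  have := integrable_withDensity_iff_integrable_smul' (μ := (volume : Measure ℝ))
    (f := fun x => ENNReal.ofReal (rho x)) (g := f) (by have := rho_cont; fun_prop) (by simp)
  simp only [ENNReal.toReal_ofReal (rho_nonneg _), smul_eq_mul] at this
  exact this

lemma integral_gauss (f : ℝ → ℝ) :
    ∫ x, f x ∂_root_.stdGaussian = ∫ x, rho x * f x := by
  unfold _root_.stdGaussian
  have := integral_withDensity_eq_integral_toReal_smul (μ := (volume : Measure ℝ))
    (f := fun x => ENNReal.ofReal (rho x)) (by have := rho_cont; fun_prop) (by simp) f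
  simp only [ENNReal.toReal_ofReal (rho_nonneg _), smul_eq_mul] at this
  exact this

lemma steinH6_cont (f : ℝ → ℝ) (hf : ContDiff ℝ 6 f) : Continuous (steinH6 f) := by
  have c : ∀ t ≤ 6, Continuous (iteratedDeriv t f) := fun t ht =>
    hf.continuous_iteratedDeriv t (by exact_mod_cast ht)
  have c0 : Continuous f := hf.continuous
  have c1 : Continuous (deriv f) := by simpa [iteratedDeriv_one] using c 1 (by norm_num)
  have c2 := c 2 (by norm_num)
  have c3 := c 3 (by norm_num)
  have c4 := c 4 (by norm_num)
  have c5 := c 5 (by norm_num)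
  have c6 := c 6 (by norm_num)
  unfold steinH6
  fun_prop

lemma int_add {μ : Measure ℝ} {f g : ℝ → ℝ} (hf : Integrable f μ) (hg : Integrable g μ) :
    Integrable (fun x => f x + g x) μ := hf.add hg

lemma integrable_stein (f : ℝ → ℝ) (μ : Measure ℝ)
    (h : ∀ t ≤ 6, ∀ j ≤ 3, Integrable (fun y => y ^ j * iteratedDeriv t f y) μ) :
    Integrable (steinH6 f) μ := by
  have e : steinH6 f = fun y => y ^ 1 * iteratedDeriv 0 f y
    + (-1278 * (y ^ 1 * iteratedDeriv 1 f y) + -720 * (y ^ 0 * iteratedDeriv 1 f y))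
    + (-972 * (y ^ 2 * iteratedDeriv 2 f y) + 103320 * (y ^ 1 * iteratedDeriv 2 f y)
      + 756000 * (y ^ 0 * iteratedDeriv 2 f y))
    + (-216 * (y ^ 3 * iteratedDeriv 3 f y) + 228960 * (y ^ 2 * iteratedDeriv 3 f y)
      + 16491600 * (y ^ 1 * iteratedDeriv 3 f y) + -120528000 * (y ^ 0 * iteratedDeriv 3 f y))
    + (71280 * (y ^ 3 * iteratedDeriv 4 f y) + 6771600 * (y ^ 2 * iteratedDeriv 4 f y)
      + -307152000 * (y ^ 1 * iteratedDeriv 4 f y) + -3265920000 * (y ^ 0 * iteratedDeriv 4 f y))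
    + (-314928000 * (y ^ 2 * iteratedDeriv 5 f y) + -19945440000 * (y ^ 1 * iteratedDeriv 5 f y)
      + 125971200000 * (y ^ 0 * iteratedDeriv 5 f y))
    + (-209952000 * (y ^ 3 * iteratedDeriv 6 f y) + -19945440000 * (y ^ 2 * iteratedDeriv 6 f y)
      + 251942400000 * (y ^ 1 * iteratedDeriv 6 f y)
      + 7558272000000 * (y ^ 0 * iteratedDeriv 6 f y)) := by
    ext y
    unfold steinH6
    simp only [iteratedDeriv_zero, iteratedDeriv_one]
    ring
  rw [e]
  have c : ∀ t ≤ 6, ∀ j ≤ 3, ∀ a : ℝ, Integrable (fun y => a * (y ^ j * iteratedDeriv t f y)) μ :=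
    fun t ht j hj a => (h t ht j hj).const_mul a
  repeat' first
    | refine int_add ?_ ?_
    | refine c _ (by norm_num) _ (by norm_num) _
    | refine h _ (by norm_num) _ (by norm_num)

set_option maxHeartbeats 2000000 in
lemma stein_lawH6 (f : ℝ → ℝ) (hf : memFH6 f) : ∫ y, steinH6 f y ∂lawH6 = 0 := by
  obtain ⟨hc, hi⟩ := hf
  have cs := steinH6_cont f hc
  have is := integrable_stein f lawH6 hi
  rw [lawH6_eq, integral_map H6_cont.aemeasurable cs.aestronglyMeasurable, integral_gauss]
  rw [lawH6_eq, integrable_map_measure cs.aestronglyMeasurable H6_cont.aemeasurable,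
    integrable_gauss] at is
  have ct : ∀ t ≤ 6, Continuous (iteratedDeriv t f) := fun t ht =>
    hc.continuous_iteratedDeriv t (by exact_mod_cast ht)
  have I : ∀ t ≤ 6, ∀ k ≤ 18, ∀ c : ℝ,
      Integrable (fun x => c * (x ^ k * iteratedDeriv t f (H6 x))) _root_.stdGaussian :=
    fun t ht k hk c => (integrable_map_H6 _ (ct t ht) (hi t ht) k hk).const_mul c
  let g : ℝ → ℝ := fun x =>
    (-1) * (x ^ 5 * iteratedDeriv 0 f (H6 x))
    + (10) * (x ^ 3 * iteratedDeriv 0 f (H6 x))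
    + (-15) * (x ^ 1 * iteratedDeriv 0 f (H6 x))
    + (-6) * (x ^ 9 * iteratedDeriv 1 f (H6 x))
    + (66) * (x ^ 7 * iteratedDeriv 1 f (H6 x))
    + (960) * (x ^ 5 * iteratedDeriv 1 f (H6 x))
    + (-12570) * (x ^ 3 * iteratedDeriv 1 f (H6 x))
    + (18450) * (x ^ 1 * iteratedDeriv 1 f (H6 x))
    + (-36) * (x ^ 13 * iteratedDeriv 2 f (H6 x))
    + (1260) * (x ^ 11 * iteratedDeriv 2 f (H6 x))
    + (-14040) * (x ^ 9 * iteratedDeriv 2 f (H6 x))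
    + (52740) * (x ^ 7 * iteratedDeriv 2 f (H6 x))
    + (-124200) * (x ^ 5 * iteratedDeriv 2 f (H6 x))
    + (1096200) * (x ^ 3 * iteratedDeriv 2 f (H6 x))
    + (-1012500) * (x ^ 1 * iteratedDeriv 2 f (H6 x))
    + (11880) * (x ^ 13 * iteratedDeriv 3 f (H6 x))
    + (-415800) * (x ^ 11 * iteratedDeriv 3 f (H6 x))
    + (5286600) * (x ^ 9 * iteratedDeriv 3 f (H6 x))
    + (-28512000) * (x ^ 7 * iteratedDeriv 3 f (H6 x))
    + (49815000) * (x ^ 5 * iteratedDeriv 3 f (H6 x))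
    + (67311000) * (x ^ 3 * iteratedDeriv 3 f (H6 x))
    + (-315657000) * (x ^ 1 * iteratedDeriv 3 f (H6 x))
    + (-5832000) * (x ^ 9 * iteratedDeriv 4 f (H6 x))
    + (169128000) * (x ^ 7 * iteratedDeriv 4 f (H6 x))
    + (-1487160000) * (x ^ 5 * iteratedDeriv 4 f (H6 x))
    + (3411720000) * (x ^ 3 * iteratedDeriv 4 f (H6 x))
    + (2624400000) * (x ^ 1 * iteratedDeriv 4 f (H6 x))
    + (-34992000) * (x ^ 13 * iteratedDeriv 5 f (H6 x))
    + (1224720000) * (x ^ 11 * iteratedDeriv 5 f (H6 x))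
    + (-15571440000) * (x ^ 9 * iteratedDeriv 5 f (H6 x))
    + (83980800000) * (x ^ 7 * iteratedDeriv 5 f (H6 x))
    + (-149590800000) * (x ^ 5 * iteratedDeriv 5 f (H6 x))
    + (-118098000000) * (x ^ 3 * iteratedDeriv 5 f (H6 x))
    + (354294000000) * (x ^ 1 * iteratedDeriv 5 f (H6 x))
  have ig : Integrable g _root_.stdGaussian := by
    simp only [g]
    repeat' first
      | refine int_add ?_ ?_
      | refine I _ (by norm_num) _ (by norm_num) _
  rw [integrable_gauss] at ig
  refine integral_eq_zero_of_hasDerivAt_of_integrable (f := fun x => rho x * g x) ?_ is ig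
  intro x
  have dH : HasDerivAt H6 (6 * x ^ 5 - 60 * x ^ 3 + 90 * x) x := by
    have := ((((hasDerivAt_pow 6 x).sub ((hasDerivAt_pow 4 x).const_mul 15)).add
      ((hasDerivAt_pow 2 x).const_mul 45)).sub_const 15)
    exact HasDerivAt.congr_deriv (f := H6) this (by norm_num; ring)
  have df : ∀ t < 6, HasDerivAt (fun x => iteratedDeriv t f (H6 x))
      (iteratedDeriv (t + 1) f (H6 x) * (6 * x ^ 5 - 60 * x ^ 3 + 90 * x)) x := by
    intro t ht
    have : HasDerivAt (iteratedDeriv t f) (iteratedDeriv (t + 1) f (H6 x)) (H6 x) := by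
      rw [iteratedDeriv_succ]
      exact (hc.differentiable_iteratedDeriv t (by exact_mod_cast ht)).differentiableAt.hasDerivAt
    exact this.comp x dH
  have d : ∀ t < 6, ∀ k : ℕ, ∀ c : ℝ, HasDerivAt (fun x => c * (x ^ k * iteratedDeriv t f (H6 x)))
      (c * (k * x ^ (k - 1) * iteratedDeriv t f (H6 x) + x ^ k *
        (iteratedDeriv (t + 1) f (H6 x) * (6 * x ^ 5 - 60 * x ^ 3 + 90 * x)))) x := by
    intro t ht k c
    exact ((hasDerivAt_pow k x).mul (df t ht)).const_mul c
  have dg := (((((((((((((((((((((((((((((((((d 0 (by norm_num) 5 (-1)).add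
    (d 0 (by norm_num) 3 (10))).add
    (d 0 (by norm_num) 1 (-15))).add
    (d 1 (by norm_num) 9 (-6))).add
    (d 1 (by norm_num) 7 (66))).add
    (d 1 (by norm_num) 5 (960))).add
    (d 1 (by norm_num) 3 (-12570))).add
    (d 1 (by norm_num) 1 (18450))).add
    (d 2 (by norm_num) 13 (-36))).add
    (d 2 (by norm_num) 11 (1260))).add
    (d 2 (by norm_num) 9 (-14040))).add
    (d 2 (by norm_num) 7 (52740))).add
    (d 2 (by norm_num) 5 (-124200))).add
    (d 2 (by norm_num) 3 (1096200))).add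
    (d 2 (by norm_num) 1 (-1012500))).add
    (d 3 (by norm_num) 13 (11880))).add
    (d 3 (by norm_num) 11 (-415800))).add
    (d 3 (by norm_num) 9 (5286600))).add
    (d 3 (by norm_num) 7 (-28512000))).add
    (d 3 (by norm_num) 5 (49815000))).add
    (d 3 (by norm_num) 3 (67311000))).add
    (d 3 (by norm_num) 1 (-315657000))).add
    (d 4 (by norm_num) 9 (-5832000))).add
    (d 4 (by norm_num) 7 (169128000))).add
    (d 4 (by norm_num) 5 (-1487160000))).add
    (d 4 (by norm_num) 3 (3411720000))).add
    (d 4 (by norm_num) 1 (2624400000))).add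
    (d 5 (by norm_num) 13 (-34992000))).add
    (d 5 (by norm_num) 11 (1224720000))).add
    (d 5 (by norm_num) 9 (-15571440000))).add
    (d 5 (by norm_num) 7 (83980800000))).add
    (d 5 (by norm_num) 5 (-149590800000))).add
    (d 5 (by norm_num) 3 (-118098000000))).add
    (d 5 (by norm_num) 1 (354294000000))
  refine HasDerivAt.congr_deriv ((rho_deriv x).mul dg) ?_
  simp only [steinH6, g, Function.comp, ← iteratedDeriv_one (f := f)]
  rw [show f (H6 x) = iteratedDeriv 0 f (H6 x) by simp]
  norm_num only
  generalize iteratedDeriv 0 f (H6 x) = f0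
  generalize iteratedDeriv 1 f (H6 x) = f1
  generalize iteratedDeriv 2 f (H6 x) = f2
  generalize iteratedDeriv 3 f (H6 x) = f3
  generalize iteratedDeriv 4 f (H6 x) = f4
  generalize iteratedDeriv 5 f (H6 x) = f5
  generalize iteratedDeriv 6 f (H6 x) = f6
  generalize rho x = r
  simp only [H6]
  ring
open scoped BoundedContinuousFunction in
lemma global_ode {E : Type*} [NormedAddCommGroup E] [NormedSpace ℝ E] [CompleteSpace E]
    (Φ : ℝ → E → E) (hΦ : Continuous (fun p : ℝ × E => Φ p.1 p.2)) (K C : ℝ) (hK : 0 < K) (hC : 0 ≤ C)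
    (hL : ∀ t x y, ‖Φ t x - Φ t y‖ ≤ K * ‖x - y‖) (h0 : ∀ t, ‖Φ t 0‖ ≤ C)
    (hz : ∀ t ≤ 0, Φ t 0 = 0) :
    ∃ v : ℝ → E, (∀ t, HasDerivAt v (Φ t (v t)) t) ∧ ∀ t ≤ 0, v t = 0 := by
  set κ : ℝ := 2 * K with hκ
  have κ0 : 0 < κ := by positivity
  have bound : ∀ (h : ℝ → E) (B τ : ℝ), 0 ≤ τ → 0 ≤ B →
      (∀ s, 0 ≤ s → ‖h s‖ ≤ B * Real.exp (κ * s)) →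
      ‖Real.exp (-κ * τ) • ∫ s in (0:ℝ)..τ, h s‖ ≤ B / κ := by
    intro h B τ hτ hB hh
    have i1 : ‖∫ s in (0:ℝ)..τ, h s‖ ≤ ∫ s in (0:ℝ)..τ, B * Real.exp (κ * s) := by
      apply intervalIntegral.norm_integral_le_of_norm_le hτ
      · exact ae_of_all _ fun s hs => hh s hs.1.le
      · exact (Continuous.intervalIntegrable (by fun_prop) _ _)
    have i2 : ∫ s in (0:ℝ)..τ, B * Real.exp (κ * s) = B / κ * (Real.exp (κ * τ) - 1) := by
      rw [intervalIntegral.integral_const_mul, intervalIntegral.integral_comp_mul_left _ κ0.ne']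
      simp [integral_exp]; ring
    rw [norm_smul, Real.norm_eq_abs, abs_of_pos (Real.exp_pos _)]
    rw [i2] at i1
    calc _ ≤ Real.exp (-κ * τ) * (B / κ * (Real.exp (κ * τ) - 1)) := by gcongr
      _ = B / κ * (1 - Real.exp (-κ * τ)) := by
        have : Real.exp (-κ * τ) * Real.exp (κ * τ) = 1 := by
          rw [← Real.exp_add]; simp
        linear_combination (B / κ) * this
      _ ≤ B / κ * 1 := by
        gcongr
        linarith [Real.exp_pos (-κ * τ)]
      _ = B / κ := mul_one _
  let g : (ℝ →ᵇ E) → ℝ → E := fun w s => Φ s (Real.exp (κ * s) • w s)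
  have gc : ∀ w, Continuous (g w) := by
    intro w
    exact hΦ.comp (continuous_id.prodMk (by fun_prop))
  let F : (ℝ →ᵇ E) → ℝ → E := fun w t =>
    Real.exp (-κ * max t 0) • ∫ s in (0:ℝ)..(max t 0), g w s
  have Fc : ∀ w, Continuous (F w) := by
    intro w
    have h1 : Continuous (fun τ : ℝ => ∫ s in (0:ℝ)..τ, g w s) :=
      intervalIntegral.continuous_primitive (fun a b => (gc w).intervalIntegrable a b) 0
    have h2 : Continuous (fun t : ℝ => max t 0) := by fun_prop
    exact (Continuous.rexp (by fun_prop)).smul (h1.comp h2)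
  have gn : ∀ w s, 0 ≤ s → ‖g w s‖ ≤ (C + K * ‖w‖) * Real.exp (κ * s) := by
    intro w s hs
    have h1 := hL s (Real.exp (κ * s) • w s) 0
    have h2 := h0 s
    have h3 : ‖g w s‖ ≤ ‖g w s - Φ s 0‖ + ‖Φ s 0‖ := by
      simpa using norm_add_le (g w s - Φ s 0) (Φ s 0)
    have h4 : (1:ℝ) ≤ Real.exp (κ * s) := Real.one_le_exp (by positivity)
    rw [sub_zero, norm_smul, Real.norm_eq_abs, abs_of_pos (Real.exp_pos _)] at h1
    have h5 := w.norm_coe_le_norm s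
    have h6 : K * (Real.exp (κ * s) * ‖w s‖) ≤ K * (Real.exp (κ * s) * ‖w‖) := by gcongr
    have h7 : C * 1 ≤ C * Real.exp (κ * s) := by gcongr
    have h8 : ‖g w s - Φ s 0‖ ≤ K * (Real.exp (κ * s) * ‖w s‖) := h1
    linarith
  let T : (ℝ →ᵇ E) → (ℝ →ᵇ E) := fun w =>
    BoundedContinuousFunction.ofNormedAddCommGroup (F w) (Fc w) ((C + K * ‖w‖) / κ)
      (fun t => bound _ _ _ (le_max_right _ _) (by positivity) (gn w))
  have Tcontr : ContractingWith (1/2 : NNReal) T := by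
    refine ⟨by norm_num, LipschitzWith.of_dist_le_mul ?_⟩
    intro w w'
    rw [BoundedContinuousFunction.dist_le (by positivity)]
    intro t
    rw [dist_eq_norm]
    have e : T w t - T w' t = Real.exp (-κ * max t 0) •
        ∫ s in (0:ℝ)..(max t 0), (g w s - g w' s) := by
      rw [intervalIntegral.integral_sub ((gc w).intervalIntegrable _ _)
        ((gc w').intervalIntegrable _ _), smul_sub]
      rfl
    rw [e]
    refine (bound _ (K * dist w w') _ (le_max_right _ _) (by positivity) ?_).trans ?_
    · intro s hs
      refine (hL _ _ _).trans ?_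
      rw [← smul_sub, norm_smul, Real.norm_eq_abs, abs_of_pos (Real.exp_pos _), ← dist_eq_norm]
      have := BoundedContinuousFunction.dist_coe_le_dist (f := w) (g := w') s
      have : K * (Real.exp (κ * s) * dist (w s) (w' s)) ≤ K * (Real.exp (κ * s) * dist w w') := by
        gcongr
      linarith
    · apply le_of_eq
      rw [hκ]; push_cast; field_simp
  obtain ⟨w, hw⟩ : ∃ w, T w = w := ⟨_, Tcontr.fixedPoint_isFixedPt⟩
  have hw' : ∀ t, w t = F w t := fun t => by
    conv_lhs => rw [← hw]
    rfl
  let v : ℝ → E := fun t => Real.exp (κ * max t 0) • w t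
  have v1 : ∀ t, v t = ∫ s in (0:ℝ)..(max t 0), g w s := by
    intro t
    simp only [v]
    rw [hw' t]
    simp only [F]
    rw [smul_smul, ← Real.exp_add]
    simp
  have vneg : ∀ t ≤ 0, v t = 0 := by
    intro t ht
    rw [v1, max_eq_right ht]; simp
  have vc : Continuous v := by fun_prop
  have gv : ∀ s, 0 ≤ s → g w s = Φ s (v s) := by
    intro s hs
    simp only [g, v, max_eq_left hs]
  have v2 : ∀ t, v t = ∫ s in (0:ℝ)..t, Φ s (v s) := by
    intro t
    rcases le_total 0 t with ht | ht
    · rw [v1, max_eq_left ht]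
      apply intervalIntegral.integral_congr
      intro s hs
      rw [uIcc_of_le ht] at hs
      exact gv s hs.1
    · rw [vneg t ht]
      symm
      rw [show (0:E) = ∫ s in (0:ℝ)..t, (0:E) by simp]
      apply intervalIntegral.integral_congr
      intro s hs
      rw [uIcc_of_ge ht] at hs
      simp only
      rw [vneg s hs.2, hz s hs.2]
  refine ⟨v, fun t => ?_, vneg⟩
  have c : Continuous (fun s => Φ s (v s)) := hΦ.comp (continuous_id.prodMk vc)
  have := intervalIntegral.integral_hasDerivAt_right (c.intervalIntegrable 0 t)
    (c.stronglyMeasurableAtFilter _ _) c.continuousAt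
  rwa [← funext v2] at this
def p0 (y : ℝ) : ℝ := y
def p1 (y : ℝ) : ℝ := -1278 * y - 720
def p2 (y : ℝ) : ℝ := -972 * y ^ 2 + 103320 * y + 756000
def p3 (y : ℝ) : ℝ := -216 * y ^ 3 + 228960 * y ^ 2 + 16491600 * y - 120528000
def p4 (y : ℝ) : ℝ := 71280 * y ^ 3 + 6771600 * y ^ 2 - 307152000 * y - 3265920000
def p5 (y : ℝ) : ℝ := -314928000 * y ^ 2 - 19945440000 * y + 125971200000
def p6 (y : ℝ) : ℝ :=
  -209952000 * y ^ 3 - 19945440000 * y ^ 2 + 251942400000 * y + 7558272000000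

lemma p_bounds (t : ℝ) (ht : 0 ≤ t) : 1 ≤ p6 (-200 - t) ∧ |p0 (-200 - t)| ≤ p6 (-200 - t) ∧
    |p1 (-200 - t)| ≤ p6 (-200 - t) ∧ |p2 (-200 - t)| ≤ p6 (-200 - t) ∧
    |p3 (-200 - t)| ≤ p6 (-200 - t) ∧ |p4 (-200 - t)| ≤ p6 (-200 - t) ∧
    |p5 (-200 - t)| ≤ p6 (-200 - t) := by
  have h2 : 0 ≤ t ^ 2 := by positivity
  have h3 : 0 ≤ t ^ 3 := by positivity
  simp only [p0, p1, p2, p3, p4, p5, p6, abs_le]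
  refine ⟨?_, ⟨?_, ?_⟩, ⟨?_, ?_⟩, ⟨?_, ?_⟩, ⟨?_, ?_⟩, ⟨?_, ?_⟩, ⟨?_, ?_⟩⟩ <;> linarith

set_option maxHeartbeats 1000000 in
lemma exists_sol : ∃ f : ℝ → ℝ, ContDiff ℝ 6 f ∧ (∀ y ≥ -200, f y = 0) ∧
    ∀ y, steinH6 f y = min (max (-200 - y) 0) 1 := by
  let Y : ℝ → ℝ := fun t => -200 - max t 0
  have Yc : Continuous Y := by fun_prop
  have pb : ∀ t, _ := fun t => p_bounds (max t 0) (le_max_right _ _)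
  have pos : ∀ t, 0 < p6 (Y t) := fun t => lt_of_lt_of_le one_pos (pb t).1
  have p6c : Continuous (fun t => p6 (Y t)) := by unfold p6; fun_prop
  have cq : ∀ p : ℝ → ℝ, Continuous p → Continuous (fun t => p (Y t) / p6 (Y t)) := fun p hp =>
    (hp.comp Yc).div p6c (fun t => (pos t).ne')
  have bq : ∀ p : ℝ → ℝ, ∀ t, |p (Y t)| ≤ p6 (Y t) → |p (Y t) / p6 (Y t)| ≤ 1 := by
    intro p t h
    rw [abs_div, abs_of_pos (pos t), div_le_one (pos t)]; exact h
  obtain ⟨a0, ha0⟩ : ∃ a : ℝ → ℝ, a = fun t => p0 (Y t) / p6 (Y t) := ⟨_, rfl⟩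
  obtain ⟨a1, ha1⟩ : ∃ a : ℝ → ℝ, a = fun t => p1 (Y t) / p6 (Y t) := ⟨_, rfl⟩
  obtain ⟨a2, ha2⟩ : ∃ a : ℝ → ℝ, a = fun t => p2 (Y t) / p6 (Y t) := ⟨_, rfl⟩
  obtain ⟨a3, ha3⟩ : ∃ a : ℝ → ℝ, a = fun t => p3 (Y t) / p6 (Y t) := ⟨_, rfl⟩
  obtain ⟨a4, ha4⟩ : ∃ a : ℝ → ℝ, a = fun t => p4 (Y t) / p6 (Y t) := ⟨_, rfl⟩
  obtain ⟨a5, ha5⟩ : ∃ a : ℝ → ℝ, a = fun t => p5 (Y t) / p6 (Y t) := ⟨_, rfl⟩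
  obtain ⟨g, hg⟩ : ∃ a : ℝ → ℝ, a = fun t => min (max t 0) 1 / p6 (Y t) := ⟨_, rfl⟩
  have c0 : Continuous a0 := ha0 ▸ cq p0 (by unfold p0; fun_prop)
  have c1 : Continuous a1 := ha1 ▸ cq p1 (by unfold p1; fun_prop)
  have c2 : Continuous a2 := ha2 ▸ cq p2 (by unfold p2; fun_prop)
  have c3 : Continuous a3 := ha3 ▸ cq p3 (by unfold p3; fun_prop)
  have c4 : Continuous a4 := ha4 ▸ cq p4 (by unfold p4; fun_prop)
  have c5 : Continuous a5 := ha5 ▸ cq p5 (by unfold p5; fun_prop)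
  have cg : Continuous g := by
    rw [hg]; exact Continuous.div (by fun_prop) p6c (fun t => (pos t).ne')
  have b0 : ∀ t, |a0 t| ≤ 1 := fun t => by rw [ha0]; exact bq p0 t (pb t).2.1
  have b1 : ∀ t, |a1 t| ≤ 1 := fun t => by rw [ha1]; exact bq p1 t (pb t).2.2.1
  have b2 : ∀ t, |a2 t| ≤ 1 := fun t => by rw [ha2]; exact bq p2 t (pb t).2.2.2.1
  have b3 : ∀ t, |a3 t| ≤ 1 := fun t => by rw [ha3]; exact bq p3 t (pb t).2.2.2.2.1
  have b4 : ∀ t, |a4 t| ≤ 1 := fun t => by rw [ha4]; exact bq p4 t (pb t).2.2.2.2.2.1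
  have b5 : ∀ t, |a5 t| ≤ 1 := fun t => by rw [ha5]; exact bq p5 t (pb t).2.2.2.2.2.2
  have bg : ∀ t, |g t| ≤ 1 := by
    intro t
    rw [hg]
    simp only
    rw [abs_div, abs_of_pos (pos t), div_le_one (pos t), abs_of_nonneg (by positivity)]
    exact (min_le_right _ _).trans (pb t).1
  have g0 : ∀ t ≤ 0, g t = 0 := by
    intro t ht
    simp [hg, max_eq_right ht]
  let R : ℝ → (Fin 6 → ℝ) → ℝ := fun t x =>
    g t - a0 t * x 0 + a1 t * x 1 - a2 t * x 2 + a3 t * x 3 - a4 t * x 4 + a5 t * x 5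
  let Φ : ℝ → (Fin 6 → ℝ) → (Fin 6 → ℝ) := fun t x => ![x 1, x 2, x 3, x 4, x 5, R t x]
  obtain ⟨v, hv, hv0⟩ := global_ode Φ (by
      refine continuous_pi fun i => ?_
      fin_cases i <;> simp [Φ, R] <;> fun_prop) 6 1 (by norm_num) (by norm_num)
    (by
      intro t x y
      rw [pi_norm_le_iff_of_nonneg (by positivity)]
      have hn : ∀ i, |x i - y i| ≤ ‖x - y‖ := fun i => norm_le_pi_norm (x - y) i
      have n0 : 0 ≤ ‖x - y‖ := norm_nonneg _
      have hm : ∀ a : ℝ, |a| ≤ 1 → ∀ i, |a * (x i - y i)| ≤ ‖x - y‖ := by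
        intro a ha i
        rw [abs_mul]
        calc |a| * |x i - y i| ≤ 1 * ‖x - y‖ := by gcongr; exact hn i
          _ = _ := one_mul _
      intro i
      fin_cases i
      · have := hn 1
        simp [Φ]; linarith
      · have := hn 2
        simp [Φ]; linarith
      · have := hn 3
        simp [Φ]; linarith
      · have := hn 4
        simp [Φ]; linarith
      · have := hn 5
        simp [Φ]; linarith
      · have k0 := abs_le.1 (hm _ (b0 t) 0)
        have k1 := abs_le.1 (hm _ (b1 t) 1)
        have k2 := abs_le.1 (hm _ (b2 t) 2)
        have k3 := abs_le.1 (hm _ (b3 t) 3)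
        have k4 := abs_le.1 (hm _ (b4 t) 4)
        have k5 := abs_le.1 (hm _ (b5 t) 5)
        have : |R t x - R t y| ≤ 6 * ‖x - y‖ := by
          simp only [R, abs_le]
          constructor <;> linarith
        simpa [Φ] using this)
    (by
      intro t
      rw [pi_norm_le_iff_of_nonneg (by positivity)]
      intro i
      have := bg t
      fin_cases i <;> simp [Φ, R, this])
    (by
      intro t ht
      ext i
      fin_cases i <;> simp [Φ, R, g0 t ht])
  have hvi : ∀ y i, HasDerivAt (fun y => v (-200 - y) i) (-Φ (-200 - y) (v (-200 - y)) i) y := by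
    intro y i
    have h1 := (hasDerivAt_pi.1 (hv (-200 - y))) i
    have h2 : HasDerivAt (fun y : ℝ => -200 - y) (-1) y := by
      simpa using (hasDerivAt_id y).const_sub (-200)
    have := HasDerivAt.comp y h1 h2
    simpa [Function.comp_def] using this
  have vc : ∀ i, Continuous (fun y => v (-200 - y) i) := fun i =>
    continuous_iff_continuousAt.2 fun y => (hvi y i).continuousAt
  let f : ℝ → ℝ := fun y => v (-200 - y) 0
  have e0 : iteratedDeriv 0 f = f := iteratedDeriv_zero
  have D0 : ∀ y, HasDerivAt f (-v (-200 - y) 1) y := fun y => hvi y 0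
  have e1 : iteratedDeriv 1 f = fun y => - v (-200 - y) 1 := by
    rw [iteratedDeriv_succ, e0]; ext y; exact (D0 y).deriv
  have D1 : ∀ y, HasDerivAt (iteratedDeriv 1 f) (v (-200 - y) 2) y := fun y => by
    rw [e1]; exact (hvi y 1).neg.congr_deriv (by simp [Φ])
  have e2 : iteratedDeriv 2 f = fun y => v (-200 - y) 2 := by
    rw [iteratedDeriv_succ]; ext y; exact (D1 y).deriv
  have D2 : ∀ y, HasDerivAt (iteratedDeriv 2 f) (-v (-200 - y) 3) y := fun y => by
    rw [e2]; exact (hvi y 2)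
  have e3 : iteratedDeriv 3 f = fun y => -v (-200 - y) 3 := by
    rw [iteratedDeriv_succ]; ext y; exact (D2 y).deriv
  have D3 : ∀ y, HasDerivAt (iteratedDeriv 3 f) (v (-200 - y) 4) y := fun y => by
    rw [e3]; exact (hvi y 3).neg.congr_deriv (by simp [Φ])
  have e4 : iteratedDeriv 4 f = fun y => v (-200 - y) 4 := by
    rw [iteratedDeriv_succ]; ext y; exact (D3 y).deriv
  have D4 : ∀ y, HasDerivAt (iteratedDeriv 4 f) (-v (-200 - y) 5) y := fun y => by
    rw [e4]; exact (hvi y 4)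
  have e5 : iteratedDeriv 5 f = fun y => -v (-200 - y) 5 := by
    rw [iteratedDeriv_succ]; ext y; exact (D4 y).deriv
  have D5 : ∀ y, HasDerivAt (iteratedDeriv 5 f) (R (-200 - y) (v (-200 - y))) y := fun y => by
    rw [e5]; exact (hvi y 5).neg.congr_deriv (by simp [Φ])
  have e6 : iteratedDeriv 6 f = fun y => R (-200 - y) (v (-200 - y)) := by
    rw [iteratedDeriv_succ]; ext y; exact (D5 y).deriv
  have f0 : ∀ y ≥ -200, f y = 0 := by
    intro y hy
    simp [f, hv0 (-200 - y) (by linarith)]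
  refine ⟨f, ?_, f0, ?_⟩
  · have vC : Continuous v := continuous_iff_continuousAt.2 fun t => (hv t).continuousAt
    have c6 : Continuous (iteratedDeriv 6 f) := by
      rw [e6]; simp only [R]; fun_prop
    rw [show (6 : WithTop ℕ∞) = ((6 : ℕ) : WithTop ℕ∞) by rfl, contDiff_nat_iff_iteratedDeriv]
    constructor
    · intro m hm
      interval_cases m
      · rw [e0]; exact vc 0
      · rw [e1]; fun_prop
      · rw [e2]; fun_prop
      · rw [e3]; fun_prop
      · rw [e4]; fun_prop
      · rw [e5]; fun_prop
      · exact c6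
    · intro m hm
      interval_cases m
      · rw [e0]; exact fun y => (D0 y).differentiableAt
      · exact fun y => (D1 y).differentiableAt
      · exact fun y => (D2 y).differentiableAt
      · exact fun y => (D3 y).differentiableAt
      · exact fun y => (D4 y).differentiableAt
      · exact fun y => (D5 y).differentiableAt
  · intro y
    have es : steinH6 f y = p0 y * f y + p1 y * iteratedDeriv 1 f y + p2 y * iteratedDeriv 2 f y
        + p3 y * iteratedDeriv 3 f y + p4 y * iteratedDeriv 4 f y + p5 y * iteratedDeriv 5 f y
        + p6 y * iteratedDeriv 6 f y := by
      simp only [iteratedDeriv_one]; rfl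
    rw [es, e1, e2, e3, e4, e5, e6]
    rcases le_total (-200) y with hy | hy
    · have z := hv0 (-200 - y) (by linarith)
      rw [max_eq_right (by linarith), f0 y hy]
      simp [z, R, g0 (-200 - y) (by linarith)]
    · have hY : Y (-200 - y) = y := by
        simp only [Y]; rw [max_eq_left (by linarith)]; ring
      have pp := pos (-200 - y)
      rw [hY] at pp
      simp only [R, ha0, ha1, ha2, ha3, ha4, ha5, hg, hY, f]
      field_simp
      ring
set_option maxHeartbeats 2000000 in
lemma energy_zero (d0 d1 d2 d3 : ℝ → ℝ) (K : ℝ)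
    (h0 : ∀ l > 0, HasDerivAt d0 (-d1 l) l)
    (h1 : ∀ l > 0, HasDerivAt d1 (-d2 l) l)
    (h2 : ∀ l > 0, HasDerivAt d2 (-d3 l) l)
    (ode : ∀ l > 0,
      l ^ 3 * (216 + 71280 * l - 209952000 * l ^ 3) * d3 l
      + l ^ 2 * (-972 - 228960 * l + 6771600 * l ^ 2 + 314928000 * l ^ 3
          - 19945440000 * l ^ 4) * d2 l
      + (1 + 1278 * l + 103320 * l ^ 2 - 16491600 * l ^ 3 - 307152000 * l ^ 4
          + 19945440000 * l ^ 5 + 251942400000 * l ^ 6) * d1 l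
      + l * (720 + 756000 * l + 120528000 * l ^ 2 - 3265920000 * l ^ 3
          - 125971200000 * l ^ 4 + 7558272000000 * l ^ 5) * d0 l = 0)
    (b0 : ∀ l > 0, l ≤ 1 → |d0 l| ≤ K * l)
    (b2 : ∀ l > 0, l ≤ 1 → |d2 l| ≤ K)
    (b1 : Tendsto d1 (𝓝[>] 0) (𝓝 0)) :
    ∀ l > 0, l < 1 / 10000 → d0 l = 0 := by
  set a : ℝ → ℝ := fun l => 216 + 71280 * l - 209952000 * l ^ 3 with ha
  set c : ℝ → ℝ := fun l => 1 + 1278 * l + 103320 * l ^ 2 - 16491600 * l ^ 3 - 307152000 * l ^ 4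
          + 19945440000 * l ^ 5 + 251942400000 * l ^ 6 with hc
  have sm : ∀ l : ℝ, 0 < l → l < 1 / 10000 → ∀ n : ℕ, 0 ≤ l ^ (n+1) ∧ l ^ (n + 1) ≤ (1/10000) ^ n * l := by
    intro l hl hl' n
    refine ⟨by positivity, ?_⟩
    rw [pow_succ]
    gcongr
  have c1 : ∀ l : ℝ, 0 < l → l < 1 / 10000 → 1 ≤ c l := by
    intro l hl hl'
    have s1 := sm l hl hl' 1
    have s2 := sm l hl hl' 2
    have s3 := sm l hl hl' 3
    have s4 := sm l hl hl' 4
    have s5 := sm l hl hl' 5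
    norm_num at s1 s2 s3 s4 s5
    simp only [hc]; linarith
  have a1 : ∀ l : ℝ, 0 < l → l < 1 / 10000 → 0 ≤ a l := by
    intro l hl hl'
    have s2 := sm l hl hl' 2
    norm_num at s2
    simp only [ha]; linarith
  set G : ℝ → ℝ := fun l => l ^ 3 * a l * d2 l ^ 2 + c l * d1 l ^ 2 + d0 l ^ 2 with hG
  have Gnn : ∀ l : ℝ, 0 < l → l < 1 / 10000 → 0 ≤ G l := by
    intro l hl hl'
    have := c1 l hl hl'
    have := a1 l hl hl'
    simp only [hG]; positivity
  let k : ℝ := 2000000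
  set P : ℝ → ℝ := fun l => Real.exp (-k * l) * G l with hP
  have key : ∀ l : ℝ, 0 < l → l < 1 / 10000 → ∃ P', HasDerivAt P P' l ∧ P' ≤ 0 := by
    intro l hl hl'
    have da : HasDerivAt a (71280 - 209952000 * (3 * l ^ 2)) l := by
      have := (((hasDerivAt_id l).const_mul 71280).const_add 216).sub
        ((hasDerivAt_pow 3 l).const_mul 209952000)
      exact HasDerivAt.congr_deriv (f := a) this (by norm_num)
    have dc : HasDerivAt c (1278 + 103320 * (2 * l) - 16491600 * (3 * l ^ 2)
        - 307152000 * (4 * l ^ 3) + 19945440000 * (5 * l ^ 4) + 251942400000 * (6 * l ^ 5)) l := by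
      have := ((((((hasDerivAt_id l).const_mul 1278).const_add 1).add
        ((hasDerivAt_pow 2 l).const_mul 103320)).sub
        ((hasDerivAt_pow 3 l).const_mul 16491600)).sub
        ((hasDerivAt_pow 4 l).const_mul 307152000)).add
        ((hasDerivAt_pow 5 l).const_mul 19945440000) |>.add
        ((hasDerivAt_pow 6 l).const_mul 251942400000)
      exact HasDerivAt.congr_deriv (f := c) this (by norm_num)
    have dG := (((hasDerivAt_pow 3 l).mul da).mul ((h2 l hl).pow 2)).add
      (dc.mul ((h1 l hl).pow 2)) |>.add ((h0 l hl).pow 2)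
    have dE : HasDerivAt (fun l => Real.exp (-k * l)) (Real.exp (-k * l) * (-k)) l := by
      have := ((hasDerivAt_id l).const_mul (-k)).exp
      simpa using this
    refine ⟨_, dE.mul dG, ?_⟩
    have s1 := sm l hl hl' 1
    have s2 := sm l hl hl' 2
    have s3 := sm l hl hl' 3
    have s4 := sm l hl hl' 4
    have s5 := sm l hl hl' 5
    norm_num at s1 s2 s3 s4 s5
    have C1 := c1 l hl hl'
    have A1 := a1 l hl hl'
    have o := ode l hl
    set D0 := d0 l
    set D1 := d1 l
    set D2 := d2 l
    set D3 := d3 l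
    set e : ℝ := 720 + 756000 * l + 120528000 * l ^ 2 - 3265920000 * l ^ 3
          - 125971200000 * l ^ 4 + 7558272000000 * l ^ 5 with he
    set b : ℝ := -972 - 228960 * l + 6771600 * l ^ 2 + 314928000 * l ^ 3
          - 19945440000 * l ^ 4 with hb
    set c' : ℝ := (1278 + 103320 * (2 * l) - 16491600 * (3 * l ^ 2)
        - 307152000 * (4 * l ^ 3) + 19945440000 * (5 * l ^ 4) + 251942400000 * (6 * l ^ 5)) with hc'
    set a' : ℝ := (71280 - 209952000 * (3 * l ^ 2)) with ha'
    have E1 : e ≤ 1000 := by rw [he]; linarith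
    have E2 : 0 ≤ e := by rw [he]; linarith
    have E3 : e ^ 2 ≤ 1000000 := by nlinarith
    have C2 : c' ≤ 10000 := by rw [hc']; linarith
    have B : 3 * a l + l * a' + 2 * b ≤ -1 := by
      have : 3 * a l + l * a' + 2 * b = -1296 - 172800 * l + 13543200 * l ^ 2
        - 629856000 * l ^ 3 - 39890880000 * l ^ 4 + 0 * l ^ 3 := by
          simp only [ha, ha', hb]; ring
      rw [this]; linarith
    have o' : l ^ 3 * a l * D3 + l ^ 2 * b * D2 + c l * D1 + l * e * D0 = 0 := o
    have main : (3 * l ^ 2 * a l + l ^ 3 * a') * D2 ^ 2 + l ^ 3 * a l * (2 * D2 * (-D3))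
        + (c' * D1 ^ 2 + c l * (2 * D1 * (-D2))) + 2 * D0 * (-D1)
        ≤ k * (l ^ 3 * a l * D2 ^ 2 + c l * D1 ^ 2 + D0 ^ 2) := by
      have e1 : (3 * l ^ 2 * a l + l ^ 3 * a') * D2 ^ 2 + l ^ 3 * a l * (2 * D2 * (-D3))
        + (c' * D1 ^ 2 + c l * (2 * D1 * (-D2))) + 2 * D0 * (-D1)
        = (3 * a l + l * a' + 2 * b) * (l * D2) ^ 2 + 2 * e * D0 * (l * D2) + c' * D1 ^ 2
          - 2 * D0 * D1 := by
        linear_combination (-2 * D2) * o'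
      rw [e1]
      have i1 : (3 * a l + l * a' + 2 * b) * (l * D2) ^ 2 ≤ -1 * (l * D2) ^ 2 := by gcongr
      have i2 : 2 * e * D0 * (l * D2) ≤ (l * D2) ^ 2 + e ^ 2 * D0 ^ 2 := by
        nlinarith [sq_nonneg (l * D2 - e * D0)]
      have i3 : e ^ 2 * D0 ^ 2 ≤ 1000000 * D0 ^ 2 := by gcongr
      have i4 : c' * D1 ^ 2 ≤ 10000 * D1 ^ 2 := by gcongr
      have i5 : 1 * D1 ^ 2 ≤ c l * D1 ^ 2 := by gcongr
      have i6 : 0 ≤ l ^ 3 * a l * D2 ^ 2 := by positivity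
      have i7 : 0 ≤ D0 ^ 2 := by positivity
      have i8 : 0 ≤ D1 ^ 2 := by positivity
      simp only [k]
      nlinarith [sq_nonneg (D0 + D1)]
    have ep := Real.exp_pos (-k * l)
    simp only [Pi.mul_apply, Pi.add_apply, Pi.pow_apply]
    push_cast
    have := mul_le_mul_of_nonneg_left main ep.le
    norm_num only at this ⊢
    simp only [pow_one]
    linarith
  have anti : AntitoneOn P (Ioo 0 (1/10000)) := by
    apply antitoneOn_of_deriv_nonpos (convex_Ioo _ _)
    · intro l hl
      obtain ⟨P', h, -⟩ := key l hl.1 hl.2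
      exact h.continuousAt.continuousWithinAt
    · intro l hl
      rw [interior_Ioo] at hl
      obtain ⟨P', h, -⟩ := key l hl.1 hl.2
      exact h.differentiableAt.differentiableWithinAt
    · intro l hl
      rw [interior_Ioo] at hl
      obtain ⟨P', h, h'⟩ := key l hl.1 hl.2
      rw [h.deriv]; exact h'
  have id0 : Tendsto (fun l : ℝ => l) (𝓝[>] 0) (𝓝 0) := tendsto_nhdsWithin_of_tendsto_nhds tendsto_id
  have near : ∀ᶠ l : ℝ in 𝓝[>] 0, 0 < l ∧ l ≤ 1 := by
    have := Ioc_mem_nhdsGT (show (0:ℝ) < 1 by norm_num)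
    filter_upwards [this] with l hl using hl
  have t0 : Tendsto d0 (𝓝[>] 0) (𝓝 0) := by
    apply squeeze_zero_norm' (a := fun l => K * l)
    · filter_upwards [near] with l hl using b0 l hl.1 hl.2
    · simpa using id0.const_mul K
  have cont : ∀ f : ℝ → ℝ, Continuous f → Tendsto f (𝓝[>] 0) (𝓝 (f 0)) := fun f hf =>
    (hf.tendsto 0).mono_left nhdsWithin_le_nhds
  have t2 : Tendsto (fun l => l ^ 3 * a l * d2 l ^ 2) (𝓝[>] 0) (𝓝 0) := by
    apply squeeze_zero_norm' (a := fun l => |l ^ 3 * a l| * K ^ 2)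
    · filter_upwards [near] with l hl
      rw [Real.norm_eq_abs, abs_mul, abs_pow]
      have := b2 l hl.1 hl.2
      gcongr
    · have := cont (fun l => |l ^ 3 * a l| * K ^ 2) (by simp only [ha]; fun_prop)
      simpa using this
  have tG : Tendsto G (𝓝[>] 0) (𝓝 0) := by
    have := (t2.add (((cont c (by simp only [hc]; fun_prop))).mul (b1.pow 2))).add (t0.pow 2)
    simpa using this
  have tP : Tendsto P (𝓝[>] 0) (𝓝 0) := by
    have := (cont (fun l => Real.exp (-k * l)) (by fun_prop)).mul tG
    rw [mul_zero] at this
    exact this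
  intro l hl hl'
  have : P l ≤ 0 := by
    apply ge_of_tendsto tP
    filter_upwards [Ioc_mem_nhdsGT hl] with x hx
    exact anti ⟨hx.1, hx.2.trans_lt hl'⟩ ⟨hl, hl'⟩ hx.2
  have g0 : G l ≤ 0 := by
    by_contra hh
    push Not at hh
    have : 0 < P l := mul_pos (Real.exp_pos _) hh
    linarith
  have := c1 l hl hl'
  have := a1 l hl hl'
  have i1 : 0 ≤ l ^ 3 * a l * d2 l ^ 2 := by positivity
  have i2 : 0 ≤ c l * d1 l ^ 2 := by positivity
  have i3 : d0 l ^ 2 ≤ 0 := by simp only [hG] at g0; linarith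
  exact pow_eq_zero_iff (two_ne_zero) |>.1 (le_antisymm i3 (sq_nonneg _))
lemma lawH6_mom : Integrable (fun y : ℝ => |y| ^ 3) lawH6 := by
  have h18 : Integrable (fun x : ℝ => ‖x‖ ^ 18) _root_.stdGaussian := by
    rw [stdGaussian_eq]
    have := (memLp_id_gaussianReal (μ := 0) (v := 1) (18 : NNReal))
    have h := MemLp.integrable_norm_pow (p := 18) (by simpa using this) (by norm_num)
    simpa using h
  have := H6_cont
  rw [lawH6_eq, integrable_map_measure (by fun_prop) H6_cont.aemeasurable]
  refine (((integrable_const (1 : ℝ)).add h18).const_mul 4000000).mono' (by fun_prop)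
    (ae_of_all _ ?_)
  intro x
  have e18 : ‖x‖ ^ 18 = (x ^ 6) ^ 3 := by
    rw [Real.norm_eq_abs, Even.pow_abs (by decide)]; ring
  have hx : 0 ≤ x ^ 6 := by positivity
  have hb : |H6 x| ≤ 100 * (1 + x ^ 6) := by
    have a2 : 0 ≤ x ^ 2 := by positivity
    have a4 : 0 ≤ x ^ 4 := by positivity
    have b2 : x ^ 2 ≤ 1 + x ^ 6 := by
      nlinarith [mul_nonneg (add_nonneg a2 zero_le_one) (sq_nonneg (x ^ 2 - 1)), sq_nonneg (x^2-1)]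
    have b4 : x ^ 4 ≤ 1 + x ^ 6 := by
      nlinarith [mul_nonneg (add_nonneg a2 zero_le_one) (sq_nonneg (x ^ 2 - 1)), sq_nonneg (x^2-1)]
    unfold H6
    rw [abs_le]; constructor <;> linarith
  have hc : |H6 x| ^ 3 ≤ (100 * (1 + x ^ 6)) ^ 3 := pow_le_pow_left₀ (abs_nonneg _) hb 3
  simp only [Real.norm_eq_abs] at e18
  simp only [Function.comp, Pi.add_apply, norm_pow, Real.norm_eq_abs, abs_abs, e18]
  have : (1 + x ^ 6) ^ 3 ≤ 4 * (1 + (x ^ 6) ^ 3) := by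
    nlinarith [mul_nonneg (add_nonneg hx zero_le_one) (sq_nonneg (x ^ 6 - 1))]
  nlinarith

lemma memF_sol (f : ℝ → ℝ) (hf : ContDiff ℝ 6 f) (h0 : ∀ y ≥ -200, f y = 0) : memFH6 f := by
  refine ⟨hf, fun t ht j hj => ?_⟩
  have hge : ∀ᵐ y ∂lawH6, -200 < y := by
    rw [lawH6_eq, ae_map_iff H6_cont.aemeasurable measurableSet_Ioi]
    refine ae_of_all _ fun x => ?_
    unfold H6
    have : 0 ≤ x ^ 2 := sq_nonneg x
    nlinarith [mul_nonneg this (sq_nonneg (x ^ 2 - 8)), sq_nonneg (x ^ 2 - 8), sq_nonneg (x^2 - 9)]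
  refine (integrable_zero ℝ ℝ lawH6).congr ?_
  filter_upwards [hge] with y hy
  have : f =ᶠ[𝓝 y] fun _ => (0 : ℝ) := by
    filter_upwards [Ioi_mem_nhds hy] with z hz
    exact h0 z (le_of_lt hz)
  rw [this.iteratedDeriv_eq t]
  simp

lemma exp_le_200 (l y : ℝ) (h0 : 0 ≤ l) (h1 : l ≤ 1) (hy : -200 ≤ y) :
    Real.exp (-l * y) ≤ Real.exp 200 := by
  apply Real.exp_le_exp.2
  nlinarith [mul_nonneg h0 (by linarith : 0 ≤ y + 200)]

lemma lap_int (m : Measure ℝ) [IsProbabilityMeasure m] (hm : ∀ᵐ y ∂m, -200 ≤ y) :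
    Iic (0 : ℝ) ⊆ integrableExpSet (fun y : ℝ => y) m := by
  intro t ht
  refine (integrable_const (Real.exp (-200 * t))).mono' (by fun_prop) ?_
  filter_upwards [hm] with y hy
  rw [Real.norm_eq_abs, abs_of_pos (Real.exp_pos _)]
  apply Real.exp_le_exp.2
  have : t ≤ 0 := ht
  nlinarith

lemma lap_interior (m : Measure ℝ) [IsProbabilityMeasure m] (hm : ∀ᵐ y ∂m, -200 ≤ y) (t : ℝ)
    (ht : t < 0) : t ∈ interior (integrableExpSet (fun y : ℝ => y) m) := by
  have := interior_mono (lap_int m hm)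
  rw [interior_Iic] at this
  exact this ht

noncomputable def lapM (m : Measure ℝ) (j : ℕ) (l : ℝ) : ℝ := ∫ y, y ^ j * Real.exp (-l * y) ∂m

lemma lapM_int (m : Measure ℝ) [IsProbabilityMeasure m] (hm : ∀ᵐ y ∂m, -200 ≤ y) (j : ℕ) (l : ℝ)
    (hl : 0 < l) : Integrable (fun y => y ^ j * Real.exp (-l * y)) m :=
  integrable_pow_mul_exp_of_mem_interior_integrableExpSet
    (lap_interior m hm (-l) (by linarith)) j

lemma lapM_deriv (m : Measure ℝ) [IsProbabilityMeasure m] (hm : ∀ᵐ y ∂m, -200 ≤ y) (j : ℕ) (l : ℝ)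
    (hl : 0 < l) : HasDerivAt (lapM m j) (-lapM m (j + 1) l) l := by
  have h := hasDerivAt_integral_pow_mul_exp_real (lap_interior m hm (-l) (by linarith)) j
  have h2 : HasDerivAt (fun l : ℝ => -l) (-1) l := hasDerivAt_neg l
  have h3 := HasDerivAt.comp l h h2
  have e : lapM m j = fun l => ∫ y, y ^ j * Real.exp (-l * y) ∂m := rfl
  rw [e]
  simpa [Function.comp_def, lapM] using h3

lemma exp_iter (l : ℝ) (t : ℕ) (y : ℝ) :
    iteratedDeriv t (fun y => Real.exp (-l * y)) y = (-l) ^ t * Real.exp (-l * y) := by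
  rw [iteratedDeriv_exp_const_mul]

lemma exp_intF (m : Measure ℝ) [IsProbabilityMeasure m] (hm : ∀ᵐ y ∂m, -200 ≤ y) (l : ℝ)
    (hl : 0 < l) (t j : ℕ) :
    Integrable (fun y => y ^ j * iteratedDeriv t (fun y => Real.exp (-l * y)) y) m := by
  refine ((lapM_int m hm j l hl).const_mul ((-l) ^ t)).congr (ae_of_all _ fun y => ?_)
  simp only [exp_iter]; ring

lemma exp_memF (l : ℝ) (hl : 0 < l) : memFH6 (fun y => Real.exp (-l * y)) :=
  ⟨by fun_prop, fun t _ j _ => exp_intF lawH6 lawH6_ge l hl t j⟩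

lemma stein_exp (m : Measure ℝ) [IsProbabilityMeasure m] (hm : ∀ᵐ y ∂m, -200 ≤ y) (l : ℝ)
    (hl : 0 < l) : ∫ y, steinH6 (fun y => Real.exp (-l * y)) y ∂m =
    l^3*(216+71280*l-209952000*l^3)*lapM m 3 l
      + l^2*(-972-228960*l+6771600*l^2+314928000*l^3-19945440000*l^4)*lapM m 2 l
      + (1+1278*l+103320*l^2-16491600*l^3-307152000*l^4+19945440000*l^5+251942400000*l^6)*lapM m 1 l
      + l*(720+756000*l+120528000*l^2-3265920000*l^3-125971200000*l^4+7558272000000*l^5)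
        *lapM m 0 l := by
  have i := fun j => lapM_int m hm j l hl
  unfold lapM
  simp only [← integral_const_mul]
  rw [← integral_add ((i 3).const_mul _) ((i 2).const_mul _),
    ← integral_add (int_add ((i 3).const_mul _) ((i 2).const_mul _)) ((i 1).const_mul _),
    ← integral_add (int_add (int_add ((i 3).const_mul _) ((i 2).const_mul _)) ((i 1).const_mul _))
      ((i 0).const_mul _)]
  congr 1
  ext y
  simp only [steinH6, ← iteratedDeriv_one (f := fun y => Real.exp (-l * y)), exp_iter]
  ring

lemma mom_int (m : Measure ℝ) [IsProbabilityMeasure m] (h3 : Integrable (fun y : ℝ => |y| ^ 3) m)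
    (j : ℕ) (hj : j ≤ 3) : Integrable (fun y : ℝ => |y| ^ j) m := by
  refine ((integrable_const (1 : ℝ)).add h3).mono' (by fun_prop) (ae_of_all _ fun y => ?_)
  simp only [norm_pow, Real.norm_eq_abs, abs_abs, Pi.add_apply]
  rcases le_total |y| 1 with h | h
  · have : |y| ^ j ≤ 1 := pow_le_one₀ (abs_nonneg _) h
    have : 0 ≤ |y| ^ 3 := by positivity
    linarith
  · have := pow_le_pow_right₀ h hj
    linarith

lemma lapM_bound (m : Measure ℝ) [IsProbabilityMeasure m] (hm : ∀ᵐ y ∂m, -200 ≤ y)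
    (h3 : Integrable (fun y : ℝ => |y| ^ 3) m) (j : ℕ) (hj : j ≤ 3) (l : ℝ) (h0 : 0 < l)
    (h1 : l ≤ 1) : |lapM m j l| ≤ Real.exp 200 * ∫ y, |y| ^ j ∂m := by
  rw [← integral_const_mul]
  rw [← Real.norm_eq_abs]
  refine norm_integral_le_of_norm_le ((mom_int m h3 j hj).const_mul _) ?_
  filter_upwards [hm] with y hy
  rw [norm_mul, norm_pow, Real.norm_eq_abs, Real.norm_eq_abs, abs_of_pos (Real.exp_pos _), mul_comm]
  have := exp_le_200 l y h0.le h1 hy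
  gcongr

lemma lapM0_bound (m : Measure ℝ) [IsProbabilityMeasure m] (hm : ∀ᵐ y ∂m, -200 ≤ y)
    (h3 : Integrable (fun y : ℝ => |y| ^ 3) m) (l : ℝ) (h0 : 0 < l)
    (h1 : l ≤ 1) : |lapM m 0 l - 1| ≤ (Real.exp 200 * ∫ y, |y| ^ 1 ∂m) * l := by
  have e : lapM m 0 l - 1 = ∫ y, (y ^ 0 * Real.exp (-l * y) - 1) ∂m := by
    rw [integral_sub (lapM_int m hm 0 l h0) (integrable_const _)]
    simp [lapM]
  rw [e, mul_right_comm, ← integral_const_mul]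
  rw [← Real.norm_eq_abs]
  refine norm_integral_le_of_norm_le ((mom_int m h3 1 (by norm_num)).const_mul _) ?_
  filter_upwards [hm] with y hy
  have a := exp_le_200 l y h0.le h1 hy
  have e1 : (1 : ℝ) ≤ Real.exp 200 := Real.one_le_exp (by norm_num)
  have b1 := Real.add_one_le_exp (-l * y)
  have b2 := Real.add_one_le_exp (-(-l * y))
  have b3 : Real.exp (-l * y) * Real.exp (-(-l * y)) = 1 := by rw [← Real.exp_add]; simp
  have pe := Real.exp_pos (-l * y)
  rw [Real.norm_eq_abs, pow_zero, one_mul, pow_one]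
  rcases le_total 0 y with h | h
  · rw [abs_of_nonneg h, abs_le]
    have : 0 ≤ l * y := by positivity
    have k : Real.exp (-l * y) ≤ 1 := Real.exp_le_one_iff.2 (by linarith)
    constructor <;> nlinarith
  · rw [abs_of_nonpos h, abs_le]
    have hh : 0 ≤ l * (-y) := mul_nonneg h0.le (by linarith)
    have k : 1 ≤ Real.exp (-l * y) := Real.one_le_exp (by linarith)
    have k2 : Real.exp (-l * y) - 1 ≤ Real.exp (-l * y) * (l * (-y)) := by nlinarith
    have k3 := mul_le_mul_of_nonneg_right a hh
    constructor <;> nlinarith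
lemma ident_meas (m n : Measure ℝ) [IsProbabilityMeasure m] [IsProbabilityMeasure n]
    (hm : ∀ᵐ y ∂m, -200 ≤ y) (hn : ∀ᵐ y ∂n, -200 ≤ y)
    (h : ∀ l > 0, l < 1 / 10000 → lapM m 0 l = lapM n 0 l) : m = n := by
  have re1 : ∀ a t : ℝ, ((a : ℂ) + t * Complex.I).re = a := by intro a t; simp
  have re2 : ∀ a t y : ℝ, (((a : ℂ) + t * Complex.I) * y).re = a * y := by intro a t y; simp
  have an : ∀ (k : Measure ℝ) [IsProbabilityMeasure k], (∀ᵐ y ∂k, -200 ≤ y) →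
      AnalyticOnNhd ℂ (complexMGF (fun y : ℝ => y) k) {z | z.re ∈ Iio (0 : ℝ)} := by
    intro k _ hk
    refine analyticOnNhd_complexMGF.mono ?_
    intro z hz
    exact lap_interior k hk z.re hz
  have eo : Set.EqOn (complexMGF (fun y : ℝ => y) m) (complexMGF (fun y : ℝ => y) n)
      {z | z.re ∈ Iio (0 : ℝ)} := by
    refine AnalyticOnNhd.eqOn_of_preconnected_of_frequently_eq (an m hm) (an n hn)
      ((convex_Iio (0 : ℝ)).linear_preimage Complex.reLm).isPreconnected
      (z₀ := ((-1 / 20000 : ℝ) : ℂ)) (by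
        simp only [Set.mem_ofPred_eq, Complex.ofReal_re, Set.mem_Iio]; norm_num) ?_
    have h_real : ∃ᶠ (x : ℝ) in 𝓝[≠] (-1 / 20000 : ℝ),
        complexMGF (fun y : ℝ => y) m x = complexMGF (fun y : ℝ => y) n x := by
      refine Eventually.frequently ?_
      refine eventually_nhdsWithin_of_eventually_nhds ?_
      filter_upwards [Ioo_mem_nhds (show (-1 / 10000 : ℝ) < -1 / 20000 by norm_num)
        (show (-1 / 20000 : ℝ) < 0 by norm_num)] with x hx
      rw [complexMGF_ofReal, complexMGF_ofReal]
      have := h (-x) (by linarith [hx.2]) (by linarith [hx.1])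
      simp only [lapM, pow_zero, one_mul, neg_neg] at this
      simp only [mgf, this]
    rw [frequently_iff_seq_forall] at h_real ⊢
    obtain ⟨xs, hx_tendsto, hx_eq⟩ := h_real
    refine ⟨fun n ↦ xs n, ?_, fun n ↦ ?_⟩
    · rw [tendsto_nhdsWithin_iff] at hx_tendsto ⊢
      constructor
      · exact (Complex.continuous_ofReal.tendsto _).comp hx_tendsto.1
      · filter_upwards [hx_tendsto.2] with k hk
        exact fun hc => hk (Complex.ofReal_injective hc)
    · simp [hx_eq]
  have lim : ∀ (k : Measure ℝ) [IsProbabilityMeasure k], (∀ᵐ y ∂k, -200 ≤ y) → ∀ t : ℝ,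
      Tendsto (fun N : ℕ => complexMGF (fun y : ℝ => y) k
        (((-(1 / ((N : ℝ) + 1)) : ℝ) : ℂ) + t * Complex.I)) atTop (𝓝 (charFun k t)) := by
    intro k _ hk t
    rw [charFun_apply_real]
    unfold complexMGF
    refine tendsto_integral_of_dominated_convergence (fun _ => Real.exp 200) (fun N => by fun_prop)
      (integrable_const _) (fun N => ?_) ?_
    · filter_upwards [hk] with y hy
      have := exp_le_200 (1 / ((N : ℝ) + 1)) y (by positivity)
        (by rw [div_le_one (by positivity)]; linarith [(Nat.cast_nonneg N : (0 : ℝ) ≤ N)]) hy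
      rw [Complex.norm_exp, re2]
      exact this
    · refine ae_of_all _ fun y => ?_
      refine (Complex.continuous_exp.tendsto _).comp ?_
      have h0 : Tendsto (fun N : ℕ => (((-(1 / ((N : ℝ) + 1)) : ℝ) : ℂ))) atTop (𝓝 0) := by
        have := tendsto_one_div_add_atTop_nhds_zero_nat (𝕜 := ℝ)
        have h2 := (Complex.continuous_ofReal.tendsto _).comp this.neg
        rw [neg_zero, Complex.ofReal_zero] at h2
        exact h2
      have := (h0.add_const ((t : ℂ) * Complex.I)).mul_const (y : ℂ)
      rw [show (t : ℂ) * y * Complex.I = (0 + t * Complex.I) * y by ring]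
      exact this
  refine Measure.ext_of_charFun ?_
  ext t
  refine tendsto_nhds_unique (lim m hm t) ((lim n hn t).congr fun N => ?_)
  refine (eo ?_).symm
  change Complex.re _ < 0
  rw [re1, neg_lt_zero]
  positivity
lemma d1_tendsto (d0 d1 d2 d3 : ℝ → ℝ) (K : ℝ)
    (ode : ∀ l>0, l^3*(216+71280*l-209952000*l^3)*d3 l + l^2*(-972-228960*l+6771600*l^2+314928000*l^3-19945440000*l^4)*d2 l + (1+1278*l+103320*l^2-16491600*l^3-307152000*l^4+19945440000*l^5+251942400000*l^6)*d1 l + l*(720+756000*l+120528000*l^2-3265920000*l^3-125971200000*l^4+7558272000000*l^5)*d0 l = 0)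
    (b0 : ∀ l > 0, l ≤ 1 → |d0 l| ≤ K) (b2 : ∀ l > 0, l ≤ 1 → |d2 l| ≤ K)
    (b3 : ∀ l > 0, l ≤ 1 → |d3 l| ≤ K) : Tendsto d1 (𝓝[>] 0) (𝓝 0) := by
  have near : ∀ᶠ l in 𝓝[>] (0 : ℝ), 0 < l ∧ l ≤ 1 := by
    filter_upwards [self_mem_nhdsWithin, Ioc_mem_nhdsGT (zero_lt_one' ℝ)] with l h h'
    exact h'
  have tz : ∀ (P d : ℝ → ℝ), Continuous P → P 0 = 0 → (∀ l > 0, l ≤ 1 → |d l| ≤ K) →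
      Tendsto (fun l => P l * d l) (𝓝[>] 0) (𝓝 0) := by
    intro P d hP h0 hd
    have h1 : Tendsto (fun l => |P l| * K) (𝓝[>] 0) (𝓝 0) := by
      have : Tendsto (fun l => |P l| * K) (𝓝 0) (𝓝 (|P 0| * K)) :=
        (Continuous.tendsto (by fun_prop) _)
      rw [h0, abs_zero, zero_mul] at this
      exact this.mono_left nhdsWithin_le_nhds
    refine squeeze_zero_norm' ?_ h1
    filter_upwards [near] with l hl
    rw [Real.norm_eq_abs, abs_mul]
    gcongr
    exact hd l hl.1 hl.2
  have q0 : Tendsto (fun l : ℝ => (1+1278*l+103320*l^2-16491600*l^3-307152000*l^4+19945440000*l^5+251942400000*l^6)) (𝓝[>] 0) (𝓝 1) := by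
    have : Tendsto (fun l : ℝ => (1+1278*l+103320*l^2-16491600*l^3-307152000*l^4+19945440000*l^5+251942400000*l^6)) (𝓝 0) (𝓝 ((fun l : ℝ => (1+1278*l+103320*l^2-16491600*l^3-307152000*l^4+19945440000*l^5+251942400000*l^6)) 0)) :=
      Continuous.tendsto (by fun_prop) _
    norm_num at this
    exact this.mono_left nhdsWithin_le_nhds
  have t3 := tz (fun l => l^3*(216+71280*l-209952000*l^3)) d3 (by fun_prop) (by norm_num) b3
  have t2 := tz (fun l => l^2*(-972-228960*l+6771600*l^2+314928000*l^3-19945440000*l^4)) d2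
    (by fun_prop) (by norm_num) b2
  have t0 := tz (fun l => l*(720+756000*l+120528000*l^2-3265920000*l^3-125971200000*l^4+7558272000000*l^5)) d0
    (by fun_prop) (by norm_num) b0
  have T := (((t3.add t2).add t0).neg).div q0 one_ne_zero
  norm_num only at T
  refine T.congr' ?_
  filter_upwards [near, q0.eventually_ne one_ne_zero] with l hl hq
  rw [Pi.div_apply, div_eq_iff hq]
  linarith [ode l hl.1]

theorem meas_eq (m : Measure ℝ) [IsProbabilityMeasure m]
    (h3 : Integrable (fun y : ℝ => |y| ^ 3) m)
    (hS : ∀ f : ℝ → ℝ, memFH6 f → ∫ y, steinH6 f y ∂m = 0) : m = lawH6 := by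
  have hm : ∀ᵐ y ∂m, -200 ≤ y := by
    obtain ⟨f, hf, f0, fs⟩ := exists_sol
    have hh := hS f (memF_sol f hf f0)
    simp only [fs] at hh
    have nn : ∀ y : ℝ, 0 ≤ min (max (-200 - y) 0) 1 := fun y => by positivity
    rw [integral_eq_zero_iff_of_nonneg nn] at hh
    · filter_upwards [hh] with y hy
      by_contra hc
      push Not at hc
      have : 0 < min (max (-200 - y) 0) 1 :=
        lt_min (lt_max_of_lt_left (by linarith)) one_pos
      simp only [Pi.zero_apply] at hy
      linarith
    · refine (integrable_const (1 : ℝ)).mono' (by fun_prop) (ae_of_all _ fun y => ?_)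
      rw [Real.norm_eq_abs, abs_of_nonneg (nn y)]
      exact min_le_right _ _
  have n3 := lawH6_mom
  have hn := lawH6_ge
  refine ident_meas m lawH6 hm hn ?_
  let d : ℕ → ℝ → ℝ := fun j l => lapM m j l - lapM lawH6 j l
  have hd : ∀ j l, 0 < l → HasDerivAt (d j) (-d (j + 1) l) l := by
    intro j l hl
    have := (lapM_deriv m hm j l hl).sub (lapM_deriv lawH6 hn j l hl)
    refine this.congr_deriv ?_
    simp only [d]; ring
  let B : ℕ → ℝ := fun j => Real.exp 200 * ∫ y, |y| ^ j ∂m + Real.exp 200 * ∫ y, |y| ^ j ∂lawH6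
  have B0 : ∀ j, 0 ≤ B j := fun j => by
    have : 0 ≤ ∫ y, |y| ^ j ∂m := integral_nonneg fun y => by positivity
    have : 0 ≤ ∫ y, |y| ^ j ∂lawH6 := integral_nonneg fun y => by positivity
    positivity
  have hb : ∀ j ≤ 3, ∀ l > 0, l ≤ 1 → |d j l| ≤ B j := by
    intro j hj l hl h1
    exact (abs_sub _ _).trans (add_le_add (lapM_bound m hm h3 j hj l hl h1)
      (lapM_bound lawH6 hn n3 j hj l hl h1))
  have hb0 : ∀ l > 0, l ≤ 1 → |d 0 l| ≤ B 1 * l := by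
    intro l hl h1
    have e : d 0 l = (lapM m 0 l - 1) - (lapM lawH6 0 l - 1) := by simp only [d]; ring
    rw [e]
    refine (abs_sub _ _).trans ((add_le_add (lapM0_bound m hm h3 l hl h1)
      (lapM0_bound lawH6 hn n3 l hl h1)).trans (le_of_eq ?_))
    simp only [B]; ring
  have ode : ∀ l>0, l^3*(216+71280*l-209952000*l^3)*d 3 l + l^2*(-972-228960*l+6771600*l^2+314928000*l^3-19945440000*l^4)*d 2 l + (1+1278*l+103320*l^2-16491600*l^3-307152000*l^4+19945440000*l^5+251942400000*l^6)*d 1 l + l*(720+756000*l+120528000*l^2-3265920000*l^3-125971200000*l^4+7558272000000*l^5)*d 0 l = 0 := by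
    intro l hl
    have a := hS _ (exp_memF l hl)
    have b := stein_lawH6 _ (exp_memF l hl)
    rw [stein_exp m hm l hl] at a
    rw [stein_exp lawH6 hn l hl] at b
    simp only [d]
    linear_combination a - b
  have K := energy_zero (d 0) (d 1) (d 2) (d 3) (B 1 + B 2) (hd 0) (hd 1) (hd 2) ode
    (fun l hl h1 => (hb0 l hl h1).trans (by
      have := mul_nonneg (B0 2) hl.le
      linarith))
    (fun l hl h1 => (hb 2 (by norm_num) l hl h1).trans (by linarith [B0 1]))
    (d1_tendsto _ _ _ _ (B 0 + B 2 + B 3) ode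
      (fun l hl h1 => (hb 0 (by norm_num) l hl h1).trans (by linarith [B0 2, B0 3]))
      (fun l hl h1 => (hb 2 (by norm_num) l hl h1).trans (by linarith [B0 0, B0 3]))
      (fun l hl h1 => (hb 3 (by norm_num) l hl h1).trans (by linarith [B0 2, B0 0])))
  intro l hl hl2
  exact sub_eq_zero.1 (K l hl hl2)

/-- Stein characterisation of `H₆(X) = X⁶ - 15X⁴ + 45X² - 15`,
`X ∼ N(0,1)`, via the operator `S₆`. -/
theorem stein_characterisation_H6
    {Ω : Type*} [MeasurableSpace Ω] (ν : Measure Ω) [IsProbabilityMeasure ν]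
    (W : Ω → ℝ) (hW : Measurable W)
    (hWmom : Integrable (fun ω => |W ω| ^ 3) ν) :
    Measure.map W ν = lawH6 ↔
      ∀ f : ℝ → ℝ, memFH6 f → ∫ ω, steinH6 f (W ω) ∂ν = 0 := by
  have key : ∀ f : ℝ → ℝ, memFH6 f →
      ∫ ω, steinH6 f (W ω) ∂ν = ∫ y, steinH6 f y ∂(Measure.map W ν) := by
    intro f hf
    rw [integral_map hW.aemeasurable (steinH6_cont f hf.1).aestronglyMeasurable]
  constructor
  · intro h f hf
    rw [key f hf, h]
    exact stein_lawH6 f hf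
  · intro h
    have : IsProbabilityMeasure (Measure.map W ν) :=
      Measure.isProbabilityMeasure_map hW.aemeasurable
    refine meas_eq _ ?_ fun f hf => (key f hf).symm.trans (h f hf)
    rw [integrable_map_measure (by fun_prop) hW.aemeasurable]
    exact hWmom
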